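/- (The ABBA code is 2-group decodable.) Let A_1 = [[1,0],[0,1]], A_2 = [[0,−1],[−1,0]], A_3 = [[0,i],[i,0]], A_4 = [[i,0],[0,i]] ∈ ℂ^{2×2} be the weight matrices of the 2×2 ABBA code. Then A_l·A_mᴴ + A_m·A_lᴴ = 0 for every l ∈ {1,2} and m ∈ {3,4}, and consequently for every number of receive antennas n_r and every channel matrix H ∈ ℂ^{n_r×2}, ⟨ṽec(H·A_l), ṽec(H·A_m)⟩ = 0 for all l ∈ {1,2}, m ∈ {3,4}; hence the columns of the equivalent channel matrix split into the two mutually orthogonal groups {1,2} and {3,4} and the corresponding R-factor is block diagonal with two 2×2 blocks. -/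

import Mathlib

open Matrix Complex
open scoped RealInnerProductSpace

/-- Realified (column-stacked) vectorization of a complex matrix. -/
noncomputable def tvec {m n : ℕ} (X : Matrix (Fin m) (Fin n) ℂ) :
    EuclideanSpace ℝ (Fin n × Fin m × Fin 2) :=
  WithLp.toLp 2 fun p => if p.2.2 = 0 then (X p.2.1 p.1).re else (X p.2.1 p.1).im

/-- The four weight matrices of the `2×2` ABBA code. -/
noncomputable def abbaA : Fin 4 → Matrix (Fin 2) (Fin 2) ℂ
  | 0 => !![1, 0; 0, 1]
  | 1 => !![0, -1; -1, 0]
  | 2 => !![0, Complex.I; Complex.I, 0]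
  | 3 => !![Complex.I, 0; 0, Complex.I]

/-- The real inner product of realified vectorizations is the real part of the
Frobenius inner product. -/
theorem inner_tvec {m n : ℕ} (X Y : Matrix (Fin m) (Fin n) ℂ) :
    ⟪tvec X, tvec Y⟫ = (X * Yᴴ).trace.re := by
  rw [PiLp.inner_apply, Fintype.sum_prod_type]
  simp only [Fintype.sum_prod_type, Fin.sum_univ_two, Matrix.trace, Matrix.diag_apply,
    Matrix.mul_apply, Complex.re_sum]
  rw [Finset.sum_comm]
  refine Finset.sum_congr rfl fun i _ => Finset.sum_congr rfl fun j _ => ?_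
  simp [tvec]
  ring

/-- Weight matrices with vanishing symmetrized product give orthogonal columns of the
equivalent channel matrix, whatever the channel. -/
theorem inner_tvec_mul_eq_zero {k m n : ℕ} (H : Matrix (Fin k) (Fin m) ℂ)
    {A B : Matrix (Fin m) (Fin n) ℂ} (h : A * Bᴴ + B * Aᴴ = 0) :
    ⟪tvec (H * A), tvec (H * B)⟫ = 0 := by
  have hsum : H * A * (H * B)ᴴ + H * B * (H * A)ᴴ = 0 := by
    calc H * A * (H * B)ᴴ + H * B * (H * A)ᴴ = H * (A * Bᴴ + B * Aᴴ) * Hᴴ := by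
          simp only [conjTranspose_mul, Matrix.mul_add, Matrix.add_mul, Matrix.mul_assoc]
      _ = 0 := by simp [h]
  have htrace := congrArg (fun M => M.trace.re) hsum
  simp only [trace_add, Complex.add_re, trace_zero, Complex.zero_re, ← inner_tvec] at htrace
  rw [real_inner_comm (tvec (H * A)) (tvec (H * B))] at htrace
  linarith

/-- The two groups of ABBA weight matrices have vanishing symmetrized products. -/
theorem abbaA_mul_conjTranspose_add (l m : Fin 4) (hl : l ∈ ({0, 1} : Set (Fin 4)))
    (hm : m ∈ ({2, 3} : Set (Fin 4))) :
    abbaA l * (abbaA m)ᴴ + abbaA m * (abbaA l)ᴴ = 0 := by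
  rcases hl with rfl | rfl <;> rcases hm with rfl | rfl <;> ext i j <;>
    fin_cases i <;> fin_cases j <;> simp [abbaA, vecMul, dotProduct]

/-- the ABBA code is 2-group decodable: `A_l·A_mᴴ + A_m·A_lᴴ = 0` for
`l ∈ {1,2}`, `m ∈ {3,4}` (0-based: `l ∈ {0,1}`, `m ∈ {2,3}`), and consequently for every
`n_r` and every `H ∈ ℂ^{n_r×2}` the corresponding columns `ṽec(H·A_l)`, `ṽec(H·A_m)` of
the equivalent channel matrix are orthogonal: the `R`-factor is block diagonal with two
`2×2` blocks. -/
theorem stmt17 :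
    (∀ l m : Fin 4, l ∈ ({0, 1} : Set (Fin 4)) → m ∈ ({2, 3} : Set (Fin 4)) →
      abbaA l * (abbaA m)ᴴ + abbaA m * (abbaA l)ᴴ = 0) ∧
    (∀ (nr : ℕ) (H : Matrix (Fin nr) (Fin 2) ℂ),
      ∀ l m : Fin 4, l ∈ ({0, 1} : Set (Fin 4)) → m ∈ ({2, 3} : Set (Fin 4)) →
        ⟪tvec (H * abbaA l), tvec (H * abbaA m)⟫ = 0) :=
  ⟨abbaA_mul_conjTranspose_add, fun _ H l m hl hm =>
    inner_tvec_mul_eq_zero H (abbaA_mul_conjTranspose_add l m hl hm)⟩
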